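/- Let L > 0, T > 0, b ∈ ℝ, β > 0. Let a₁, a₂ : ℝ × [0,L] → ℝ be continuously differentiable, bounded and nonnegative, let a₀ : ℝ × [0,L] → ℝ be continuous and bounded, and suppose there exist measurable functions β₂, β₀ : ℝ → ℝ with a₂(x,y) ≥ β₂(x) ≥ 0 and a₀(x,y) ≥ β₀(x) for all (x,y), and π² β₂(x)/L² + β₀(x) ≥ β for all x ∈ ℝ. Let u : [0,T] × ℝ × [0,L] → ℝ be infinitely differentiable, vanishing whenever |x| ≥ R for some R > 0, satisfying u(t,x,0) = u(t,x,L) = 0 for all t, x, and satisfying pointwise the generalized Zakharov–Kuznetsov equation u_t + b u_x + u_xxx + u_xyy + u u_x − (a₁ u_x)_x − (a₂ u_y)_y + a₀ u = 0. Then for all t ∈ [0,T]: (∬_Σ u²(t,x,y) dx dy)^{1/2} ≤ e^{−β t} (∬_Σ u²(0,x,y) dx dy)^{1/2}. -/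

import Mathlib

open MeasureTheory Real Set

noncomputable section

/-- Partial derivative in the time variable. -/
def Dt (u : ℝ → ℝ → ℝ → ℝ) (t x y : ℝ) : ℝ := deriv (fun s => u s x y) t

/-- Partial derivative in `x`. -/
def Dx (u : ℝ → ℝ → ℝ → ℝ) (t x y : ℝ) : ℝ := deriv (fun s => u t s y) x

/-- Partial derivative in `y`. -/
def Dy (u : ℝ → ℝ → ℝ → ℝ) (t x y : ℝ) : ℝ := deriv (fun s => u t x s) y

section PartialDerivatives

variable {f : ℝ → ℝ → ℝ → ℝ}

lemma hasDerivAt_Dt (hf : ContDiff ℝ 1 (fun p : ℝ × ℝ × ℝ => f p.1 p.2.1 p.2.2)) (t x y : ℝ) :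
    HasDerivAt (fun s => f s x y) (Dt f t x y) t := by
  have h : Differentiable ℝ (fun s : ℝ => f s x y) :=
    (hf.comp (contDiff_id.prodMk contDiff_const :
      ContDiff ℝ 1 (fun s : ℝ => (s, x, y)))).differentiable one_ne_zero
  exact (h t).hasDerivAt

lemma hasDerivAt_Dx (hf : ContDiff ℝ 1 (fun p : ℝ × ℝ × ℝ => f p.1 p.2.1 p.2.2)) (t x y : ℝ) :
    HasDerivAt (fun s => f t s y) (Dx f t x y) x := by
  have h : Differentiable ℝ (fun s : ℝ => f t s y) :=
    (hf.comp (contDiff_const.prodMk (contDiff_id.prodMk contDiff_const) :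
      ContDiff ℝ 1 (fun s : ℝ => (t, s, y)))).differentiable one_ne_zero
  exact (h x).hasDerivAt

lemma hasDerivAt_Dy (hf : ContDiff ℝ 1 (fun p : ℝ × ℝ × ℝ => f p.1 p.2.1 p.2.2)) (t x y : ℝ) :
    HasDerivAt (fun s => f t x s) (Dy f t x y) y := by
  have h : Differentiable ℝ (fun s : ℝ => f t x s) :=
    (hf.comp (contDiff_const.prodMk (contDiff_const.prodMk contDiff_id) :
      ContDiff ℝ 1 (fun s : ℝ => (t, x, s)))).differentiable one_ne_zero
  exact (h y).hasDerivAt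

lemma Dt_eq_fderiv (hf : ContDiff ℝ 1 (fun p : ℝ × ℝ × ℝ => f p.1 p.2.1 p.2.2)) (t x y : ℝ) :
    Dt f t x y = fderiv ℝ (fun p : ℝ × ℝ × ℝ => f p.1 p.2.1 p.2.2) (t, x, y) (1, 0, 0) := by
  have h := (hf.differentiable one_ne_zero (t, x, y)).hasFDerivAt
  exact (h.comp_hasDerivAt t ((hasDerivAt_id t).prodMk
    ((hasDerivAt_const t x).prodMk (hasDerivAt_const t y)))).deriv

lemma Dx_eq_fderiv (hf : ContDiff ℝ 1 (fun p : ℝ × ℝ × ℝ => f p.1 p.2.1 p.2.2)) (t x y : ℝ) :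
    Dx f t x y = fderiv ℝ (fun p : ℝ × ℝ × ℝ => f p.1 p.2.1 p.2.2) (t, x, y) (0, 1, 0) := by
  have h := (hf.differentiable one_ne_zero (t, x, y)).hasFDerivAt
  exact (h.comp_hasDerivAt x ((hasDerivAt_const x t).prodMk
    ((hasDerivAt_id x).prodMk (hasDerivAt_const x y)))).deriv

lemma Dy_eq_fderiv (hf : ContDiff ℝ 1 (fun p : ℝ × ℝ × ℝ => f p.1 p.2.1 p.2.2)) (t x y : ℝ) :
    Dy f t x y = fderiv ℝ (fun p : ℝ × ℝ × ℝ => f p.1 p.2.1 p.2.2) (t, x, y) (0, 0, 1) := by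
  have h := (hf.differentiable one_ne_zero (t, x, y)).hasFDerivAt
  exact (h.comp_hasDerivAt y ((hasDerivAt_const y t).prodMk
    ((hasDerivAt_const y x).prodMk (hasDerivAt_id y)))).deriv

lemma contDiff_Dt {m n : WithTop ℕ∞} (hmn : m + 1 ≤ n)
    (hf : ContDiff ℝ n (fun p : ℝ × ℝ × ℝ => f p.1 p.2.1 p.2.2)) :
    ContDiff ℝ m (fun p : ℝ × ℝ × ℝ => Dt f p.1 p.2.1 p.2.2) := by
  simp only [Dt_eq_fderiv (hf.of_le (le_add_self.trans hmn))]
  exact (hf.fderiv_right hmn).clm_apply contDiff_const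

lemma contDiff_Dx {m n : WithTop ℕ∞} (hmn : m + 1 ≤ n)
    (hf : ContDiff ℝ n (fun p : ℝ × ℝ × ℝ => f p.1 p.2.1 p.2.2)) :
    ContDiff ℝ m (fun p : ℝ × ℝ × ℝ => Dx f p.1 p.2.1 p.2.2) := by
  simp only [Dx_eq_fderiv (hf.of_le (le_add_self.trans hmn))]
  exact (hf.fderiv_right hmn).clm_apply contDiff_const

lemma contDiff_Dy {m n : WithTop ℕ∞} (hmn : m + 1 ≤ n)
    (hf : ContDiff ℝ n (fun p : ℝ × ℝ × ℝ => f p.1 p.2.1 p.2.2)) :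
    ContDiff ℝ m (fun p : ℝ × ℝ × ℝ => Dy f p.1 p.2.1 p.2.2) := by
  simp only [Dy_eq_fderiv (hf.of_le (le_add_self.trans hmn))]
  exact (hf.fderiv_right hmn).clm_apply contDiff_const

lemma Dx_Dy_comm (hf : ContDiff ℝ 2 (fun p : ℝ × ℝ × ℝ => f p.1 p.2.1 p.2.2)) (t x y : ℝ) :
    Dx (Dy f) t x y = Dy (Dx f) t x y := by
  have h1 : ContDiff ℝ 1 (fun p : ℝ × ℝ × ℝ => f p.1 p.2.1 p.2.2) := hf.of_le one_le_two
  have h2 : ContDiff ℝ 1 (fderiv ℝ (fun p : ℝ × ℝ × ℝ => f p.1 p.2.1 p.2.2)) :=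
    hf.fderiv_right (by norm_num [one_add_one_eq_two])
  have h3 := (h2.differentiable one_ne_zero (t, x, y)).hasFDerivAt
  have key : ∀ v w : ℝ × ℝ × ℝ,
      fderiv ℝ (fun p => fderiv ℝ (fun p : ℝ × ℝ × ℝ => f p.1 p.2.1 p.2.2) p v) (t, x, y) w
        = fderiv ℝ (fderiv ℝ (fun p : ℝ × ℝ × ℝ => f p.1 p.2.1 p.2.2)) (t, x, y) w v := by
    intro v w
    rw [(h3.clm_apply (hasFDerivAt_const v _)).fderiv]
    simp
  rw [Dx_eq_fderiv (contDiff_Dy (by norm_num [one_add_one_eq_two]) hf),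
    Dy_eq_fderiv (contDiff_Dx (by norm_num [one_add_one_eq_two]) hf)]
  simp only [Dx_eq_fderiv h1, Dy_eq_fderiv h1]
  rw [key, key]
  exact hf.contDiffAt.isSymmSndFDerivAt (by simp) _ _

end PartialDerivatives

/-- Differentiation under the integral sign for a jointly continuous derivative. -/
lemma hasDerivAt_intervalIntegral_of_continuous {F F' : ℝ → ℝ → ℝ}
    (hF : Continuous (Function.uncurry F)) (hF' : Continuous (Function.uncurry F'))
    (hd : ∀ t x, HasDerivAt (fun s => F s x) (F' t x) t) (a b t : ℝ) :
    HasDerivAt (fun s => ∫ x in a..b, F s x) (∫ x in a..b, F' t x) t := by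
  obtain ⟨C, hC⟩ := ((isCompact_closedBall t 1).prod
    (isCompact_uIcc (a := a) (b := b))).exists_bound_of_continuousOn hF'.continuousOn
  refine (intervalIntegral.hasDerivAt_integral_of_dominated_loc_of_deriv_le
    (bound := fun _ => C) (Metric.closedBall_mem_nhds t one_pos) ?_ ?_ ?_ ?_ ?_ ?_).2
  · exact Filter.Eventually.of_forall fun s =>
      (hF.comp (Continuous.prodMk_right s)).aestronglyMeasurable
  · exact (hF.comp (Continuous.prodMk_right t)).intervalIntegrable _ _
  · exact (hF'.comp (Continuous.prodMk_right t)).aestronglyMeasurable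
  · exact Filter.Eventually.of_forall fun x hx s hs => hC (s, x) ⟨hs, uIoc_subset_uIcc hx⟩
  · exact intervalIntegrable_const
  · exact Filter.Eventually.of_forall fun x _ s _ => hd s x

/-- Differentiation under a double integral over a rectangle. -/
lemma hasDerivAt_integral_integral_Dt {f : ℝ → ℝ → ℝ → ℝ}
    (hf : ContDiff ℝ 1 (fun p : ℝ × ℝ × ℝ => f p.1 p.2.1 p.2.2)) (a b c d t : ℝ) :
    HasDerivAt (fun s => ∫ x in a..b, ∫ y in c..d, f s x y)
      (∫ x in a..b, ∫ y in c..d, Dt f t x y) t := by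
  have hc := hf.continuous
  have hc' := (contDiff_Dt (m := 0) (by norm_num) hf).continuous
  refine hasDerivAt_intervalIntegral_of_continuous
    (F := fun s x => ∫ y in c..d, f s x y) (F' := fun s x => ∫ y in c..d, Dt f s x y)
    ?_ ?_ (fun s x => ?_) a b t
  · exact intervalIntegral.continuous_parametric_intervalIntegral_of_continuous'
      (f := fun (p : ℝ × ℝ) y => f p.1 p.2 y)
      (hc.comp (by fun_prop : Continuous fun q : (ℝ × ℝ) × ℝ => (q.1.1, q.1.2, q.2))) c d
  · exact intervalIntegral.continuous_parametric_intervalIntegral_of_continuous'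
      (f := fun (p : ℝ × ℝ) y => Dt f p.1 p.2 y)
      (hc'.comp (by fun_prop : Continuous fun q : (ℝ × ℝ) × ℝ => (q.1.1, q.1.2, q.2))) c d
  · exact hasDerivAt_intervalIntegral_of_continuous
      (F := fun s y => f s x y) (F' := fun s y => Dt f s x y)
      (hc.comp (by fun_prop : Continuous fun q : ℝ × ℝ => (q.1, x, q.2)))
      (hc'.comp (by fun_prop : Continuous fun q : ℝ × ℝ => (q.1, x, q.2)))
      (fun r y => hasDerivAt_Dt hf r x y) c d s

/-- The double integral of an `x`-derivative vanishes if the primitive vanishes on the two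
sides of the rectangle. -/
lemma integral_integral_Dx_eq_zero {f : ℝ → ℝ → ℝ → ℝ}
    (hf : ContDiff ℝ 1 (fun p : ℝ × ℝ × ℝ => f p.1 p.2.1 p.2.2)) {a b c d t : ℝ}
    (ha : ∀ y, f t a y = 0) (hb : ∀ y, f t b y = 0) :
    ∫ x in a..b, ∫ y in c..d, Dx f t x y = 0 := by
  have hc' := (contDiff_Dx (m := 0) (by norm_num) hf).continuous
  have hc2 : Continuous (Function.uncurry fun x y => Dx f t x y) :=
    hc'.comp (by fun_prop : Continuous fun q : ℝ × ℝ => (t, q.1, q.2))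
  rw [intervalIntegral_intervalIntegral_swap ((hc2.continuousOn.integrableOn_compact
    (isCompact_uIcc.prod isCompact_uIcc)).mono_set (prod_mono uIoc_subset_uIcc uIoc_subset_uIcc))]
  have : ∀ y, ∫ x in a..b, Dx f t x y = 0 := fun y => by
    rw [intervalIntegral.integral_eq_sub_of_hasDerivAt (fun x _ => hasDerivAt_Dx hf t x y)
      ((hc2.comp (by fun_prop : Continuous fun x : ℝ => (x, y))).intervalIntegrable _ _), ha, hb,
      sub_zero]
  simp [this]

/-- The function `k cot (k y) v²` extends continuously by zero to a zero `c` of both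
`v` and `sin (k ·)`. -/
lemma continuousAt_cos_mul_sq_div_sin {v : ℝ → ℝ} {k c v' : ℝ} (hk : k ≠ 0)
    (hv : HasDerivAt v v' c) (hvc : v c = 0) (hs : sin (k * c) = 0) :
    ContinuousAt (fun y => k * cos (k * y) * v y ^ 2 / sin (k * y)) c := by
  have hcos : cos (k * c) ≠ 0 := by
    intro h
    have := sin_sq_add_cos_sq (k * c)
    simp [h, hs] at this
  have hsin : HasDerivAt (fun y => sin (k * y)) (cos (k * c) * (k * 1)) c :=
    ((hasDerivAt_id c).const_mul k).sin
  have h1 := (hasDerivAt_iff_tendsto_slope.1 hv).div (hasDerivAt_iff_tendsto_slope.1 hsin)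
    (by simp [hcos, hk])
  have h2 : Filter.Tendsto (fun y => k * cos (k * y) * v y) (nhdsWithin c {c}ᶜ)
      (nhds (k * cos (k * c) * v c)) :=
    ((by fun_prop : ContinuousAt (fun y => k * cos (k * y)) c).mul
      hv.continuousAt).tendsto.mono_left nhdsWithin_le_nhds
  rw [← continuousWithinAt_compl_self]
  have h3 := h2.mul h1
  rw [hvc, mul_zero, zero_mul] at h3
  rw [ContinuousWithinAt, hvc]
  rw [zero_pow two_ne_zero, mul_zero, zero_div]
  refine h3.congr' ?_
  filter_upwards [self_mem_nhdsWithin] with y hy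
  have hyc : y - c ≠ 0 := sub_ne_zero.2 hy
  rw [Pi.div_apply, slope_def_field, slope_def_field, hvc, hs, sub_zero, sub_zero,
    div_div_div_cancel_right₀ hyc]
  ring

/-- **Wirtinger's (Friedrichs') inequality** on `[0, L]` with the sharp constant. -/
lemma wirtinger_inequality {L : ℝ} (hL : 0 < L) {v v' : ℝ → ℝ}
    (hv : ∀ y, HasDerivAt v (v' y) y) (hv' : Continuous v') (h0 : v 0 = 0) (hvL : v L = 0) :
    0 ≤ ∫ y in (0:ℝ)..L, (v' y ^ 2 - (π / L) ^ 2 * v y ^ 2) := by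
  have hvc : Continuous v := continuous_iff_continuousAt.2 fun y => (hv y).continuousAt
  set k := π / L with hk
  have hk0 : 0 < k := div_pos pi_pos hL
  have hkL : k * L = π := div_mul_cancel₀ _ hL.ne'
  have hsin : ∀ y ∈ Ioo (0:ℝ) L, 0 < sin (k * y) := fun y hy =>
    sin_pos_of_pos_of_lt_pi (mul_pos hk0 hy.1) (hkL ▸ mul_lt_mul_of_pos_left hy.2 hk0)
  have hderiv : ∀ y ∈ Ioo (0:ℝ) L, HasDerivAt (fun y => k * cos (k * y) * v y ^ 2 / sin (k * y))
      (v' y ^ 2 - k ^ 2 * v y ^ 2 - (v' y - k * cos (k * y) * v y / sin (k * y)) ^ 2) y := by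
    intro y hy
    have hs := (hsin y hy).ne'
    have hlin : HasDerivAt (fun y : ℝ => k * y) (k * 1) y := (hasDerivAt_id y).const_mul k
    refine (((hlin.cos.const_mul k).mul ((hv y).pow 2)).div hlin.sin hs).congr_deriv ?_
    simp only [Pi.mul_apply, Pi.pow_apply]
    field_simp
    norm_num
    ring
  have h := intervalIntegral.sub_le_integral_of_hasDeriv_right_of_le
    (g := fun y => k * cos (k * y) * v y ^ 2 / sin (k * y))
    (φ := fun y => v' y ^ 2 - k ^ 2 * v y ^ 2) hL.le ?_
    (fun y hy => (hderiv y hy).hasDerivWithinAt) ?_ ?_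
  · simpa [h0, hvL] using h
  · intro y hy
    refine ContinuousAt.continuousWithinAt ?_
    rcases hy.1.eq_or_lt with rfl | hy0
    · exact continuousAt_cos_mul_sq_div_sin hk0.ne' (hv 0) h0 (by simp)
    rcases hy.2.eq_or_lt with rfl | hyL
    · exact continuousAt_cos_mul_sq_div_sin hk0.ne' (hv y) hvL (by rw [hkL, sin_pi])
    · exact (hderiv y ⟨hy0, hyL⟩).continuousAt
  · exact (by fun_prop : Continuous fun y => v' y ^ 2 - k ^ 2 * v y ^ 2).continuousOn
      |>.integrableOn_compact isCompact_Icc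
  · intro y _
    exact sub_le_self _ (sq_nonneg _)

/-- Local form of the energy identity: multiplying the equation by `u` gives a divergence plus
the dissipation and absorption terms. -/
lemma exists_flux {b : ℝ} {a₁ a₂ a₀ : ℝ → ℝ → ℝ} {u : ℝ → ℝ → ℝ → ℝ}
    (ha₁ : ContDiff ℝ 1 (fun p : ℝ × ℝ => a₁ p.1 p.2))
    (ha₂ : ContDiff ℝ 1 (fun p : ℝ × ℝ => a₂ p.1 p.2))
    (hu : ContDiff ℝ (⊤ : ℕ∞) (fun p : ℝ × ℝ × ℝ => u p.1 p.2.1 p.2.2)) :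
    ∃ P Q : ℝ → ℝ → ℝ → ℝ,
      ContDiff ℝ 1 (fun p : ℝ × ℝ × ℝ => P p.1 p.2.1 p.2.2) ∧
      ContDiff ℝ 1 (fun p : ℝ × ℝ × ℝ => Q p.1 p.2.1 p.2.2) ∧
      (∀ t x y, u t x y = 0 → Dx u t x y = 0 → Dy u t x y = 0 → P t x y = 0) ∧
      (∀ t x y, u t x y = 0 → Dx u t x y = 0 → Q t x y = 0) ∧
      ∀ t x y, Dt u t x y + b * Dx u t x y + Dx (Dx (Dx u)) t x y + Dx (Dy (Dy u)) t x y
          + u t x y * Dx u t x y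
          - Dx (fun t x y => a₁ x y * Dx u t x y) t x y
          - Dy (fun t x y => a₂ x y * Dy u t x y) t x y
          + a₀ x y * u t x y = 0 →
        u t x y * Dt u t x y = -Dx P t x y - Dy Q t x y - a₁ x y * Dx u t x y ^ 2
          - a₂ x y * Dy u t x y ^ 2 - a₀ x y * u t x y ^ 2 := by
  have htop : ((⊤ : ℕ∞) : WithTop ℕ∞) + 1 ≤ ((⊤ : ℕ∞) : WithTop ℕ∞) := le_of_eq rfl
  have hone : (1 : WithTop ℕ∞) ≤ ((⊤ : ℕ∞) : WithTop ℕ∞) := by exact_mod_cast le_top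
  have htwo : (2 : WithTop ℕ∞) ≤ ((⊤ : ℕ∞) : WithTop ℕ∞) :=
    WithTop.coe_le_coe.2 (le_top : (2 : ℕ∞) ≤ ⊤)
  have hux := contDiff_Dx htop hu
  have huy := contDiff_Dy htop hu
  have hu1 := hu.of_le hone
  have hux1 := hux.of_le hone
  have huy1 := huy.of_le hone
  have huxx1 := (contDiff_Dx htop hux).of_le hone
  have huyy1 := (contDiff_Dy htop huy).of_le hone
  have hproj : ContDiff ℝ 1 (fun p : ℝ × ℝ × ℝ => (p.2.1, p.2.2)) := by fun_prop
  have hf1 : ContDiff ℝ 1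
      (fun p : ℝ × ℝ × ℝ => (fun t x y => a₁ x y * Dx u t x y) p.1 p.2.1 p.2.2) :=
    (ha₁.comp hproj).mul hux1
  have hf2 : ContDiff ℝ 1
      (fun p : ℝ × ℝ × ℝ => (fun t x y => a₂ x y * Dy u t x y) p.1 p.2.1 p.2.2) :=
    (ha₂.comp hproj).mul huy1
  obtain ⟨P, hPdef⟩ : ∃ P : ℝ → ℝ → ℝ → ℝ, P = fun t x y => b / 2 * u t x y ^ 2 + u t x y * Dx (Dx u) t x y - 1 / 2 * Dx u t x y ^ 2
      + 1 / 3 * u t x y ^ 3 - u t x y * (a₁ x y * Dx u t x y) + u t x y * Dy (Dy u) t x y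
      + 1 / 2 * Dy u t x y ^ 2 := ⟨_, rfl⟩
  obtain ⟨Q, hQdef⟩ : ∃ Q : ℝ → ℝ → ℝ → ℝ, Q = fun t x y =>
      -(Dx u t x y * Dy u t x y) - u t x y * (a₂ x y * Dy u t x y) := ⟨_, rfl⟩
  refine ⟨P, Q, ?_, ?_, ?_, ?_, ?_⟩
  · rw [hPdef]
    exact ((((((contDiff_const.mul (hu1.pow 2)).add (hu1.mul huxx1)).sub
      (contDiff_const.mul (hux1.pow 2))).add (contDiff_const.mul (hu1.pow 3))).sub
      (hu1.mul hf1)).add (hu1.mul huyy1)).add (contDiff_const.mul (huy1.pow 2))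
  · rw [hQdef]
    exact (hux1.mul huy1).neg.sub (hu1.mul hf2)
  · intro t x y h h1 h2
    simp [hPdef, h, h1, h2]
  · intro t x y h h1
    simp [hQdef, h, h1]
  · intro t x y h
    have dux := hasDerivAt_Dx hu1 t x y
    have duy := hasDerivAt_Dy hu1 t x y
    have hP : Dx P t x y = u t x y * (b * Dx u t x y + Dx (Dx (Dx u)) t x y
        + u t x y * Dx u t x y - Dx (fun t x y => a₁ x y * Dx u t x y) t x y
        + Dx (Dy (Dy u)) t x y) - a₁ x y * Dx u t x y ^ 2
        + Dx u t x y * Dy (Dy u) t x y + Dy u t x y * Dx (Dy u) t x y := by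
      rw [hPdef]
      refine ((((((((dux.pow 2).const_mul (b / 2)).add
      (dux.mul (hasDerivAt_Dx huxx1 t x y))).sub
      (((hasDerivAt_Dx hux1 t x y).pow 2).const_mul (1 / 2))).add
      ((dux.pow 3).const_mul (1 / 3))).sub (dux.mul (hasDerivAt_Dx (f := fun t x y => a₁ x y * Dx u t x y) hf1 t x y))).add
      (dux.mul (hasDerivAt_Dx huyy1 t x y))).add
      (((hasDerivAt_Dx huy1 t x y).pow 2).const_mul (1 / 2))).deriv.trans ?_
      norm_num
      ring
    have hQ : Dy Q t x y = -(Dy (Dx u) t x y * Dy u t x y) - Dx u t x y * Dy (Dy u) t x y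
        - a₂ x y * Dy u t x y ^ 2
        - u t x y * Dy (fun t x y => a₂ x y * Dy u t x y) t x y := by
      rw [hQdef]
      refine (((hasDerivAt_Dy hux1 t x y).mul (hasDerivAt_Dy huy1 t x y)).neg.sub
      (duy.mul (hasDerivAt_Dy (f := fun t x y => a₂ x y * Dy u t x y) hf2 t x y))).deriv.trans ?_
      ring
    have hcomm := Dx_Dy_comm (hu.of_le htwo) t x y
    rw [hP, hQ, hcomm]
    linear_combination u t x y * h

/-- Exponential decay in `L²` for smooth solutions of the generalized
Zakharov–Kuznetsov equation when dissipation or absorption is effective at every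
point of the strip. -/
theorem exponential_decay (L T b β : ℝ) (hL : 0 < L) (hT : 0 < T) (hβ : 0 < β)
    (a₁ a₂ a₀ : ℝ → ℝ → ℝ) (β₂ β₀ : ℝ → ℝ)
    (ha₁ : ContDiff ℝ 1 (fun p : ℝ × ℝ => a₁ p.1 p.2))
    (ha₂ : ContDiff ℝ 1 (fun p : ℝ × ℝ => a₂ p.1 p.2))
    (ha₀ : Continuous (fun p : ℝ × ℝ => a₀ p.1 p.2))
    (ha₁b : ∃ M : ℝ, ∀ x y : ℝ, |a₁ x y| ≤ M)
    (ha₂b : ∃ M : ℝ, ∀ x y : ℝ, |a₂ x y| ≤ M)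
    (ha₀b : ∃ M : ℝ, ∀ x y : ℝ, |a₀ x y| ≤ M)
    (ha₁nn : ∀ x y : ℝ, 0 ≤ a₁ x y) (ha₂nn : ∀ x y : ℝ, 0 ≤ a₂ x y)
    (hβ₂m : Measurable β₂) (hβ₀m : Measurable β₀)
    (hβ₂ : ∀ x y : ℝ, β₂ x ≤ a₂ x y) (hβ₂nn : ∀ x : ℝ, 0 ≤ β₂ x)
    (hβ₀ : ∀ x y : ℝ, β₀ x ≤ a₀ x y)
    (hcoer : ∀ x : ℝ, β ≤ Real.pi ^ 2 * β₂ x / L ^ 2 + β₀ x)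
    (u : ℝ → ℝ → ℝ → ℝ)
    (hu : ContDiff ℝ (⊤ : ℕ∞) (fun p : ℝ × ℝ × ℝ => u p.1 p.2.1 p.2.2))
    (hsupp : ∃ R > 0, ∀ t x y : ℝ, R ≤ |x| → u t x y = 0)
    (hbc0 : ∀ t x : ℝ, u t x 0 = 0) (hbcL : ∀ t x : ℝ, u t x L = 0)
    (heq : ∀ t ∈ Icc (0:ℝ) T, ∀ x : ℝ, ∀ y ∈ Icc (0:ℝ) L,
      Dt u t x y + b * Dx u t x y + Dx (Dx (Dx u)) t x y + Dx (Dy (Dy u)) t x y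
          + u t x y * Dx u t x y
          - Dx (fun t x y => a₁ x y * Dx u t x y) t x y
          - Dy (fun t x y => a₂ x y * Dy u t x y) t x y
          + a₀ x y * u t x y
        = 0) :
    ∀ t ∈ Icc (0:ℝ) T,
      (∫ x : ℝ, ∫ y in Ioo (0:ℝ) L, (u t x y) ^ 2) ^ ((1:ℝ) / 2)
        ≤ Real.exp (-(β * t))
            * (∫ x : ℝ, ∫ y in Ioo (0:ℝ) L, (u 0 x y) ^ 2) ^ ((1:ℝ) / 2) := by
  obtain ⟨R, hR, hsupp⟩ := hsupp
  obtain ⟨P, Q, hP, hQ, hP0, hQ0, hflux⟩ := exists_flux (b := b) (a₀ := a₀) ha₁ ha₂ hu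
  have hu1 : ContDiff ℝ 1 (fun p : ℝ × ℝ × ℝ => u p.1 p.2.1 p.2.2) :=
    hu.of_le (by exact_mod_cast le_top)
  have hE : ∀ t, ∫ x : ℝ, ∫ y in Ioo (0:ℝ) L, u t x y ^ 2
      = ∫ x in -(R + 1)..(R + 1), ∫ y in (0:ℝ)..L, u t x y ^ 2 := by
    intro t
    simp only [intervalIntegral.integral_of_le hL.le, integral_Ioc_eq_integral_Ioo]
    refine (intervalIntegral.integral_eq_integral_of_support_subset fun x hx => ?_).symm
    by_contra hxR
    refine hx ?_
    have hx' : R ≤ |x| := by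
      by_contra! hlt
      exact hxR ⟨by linarith [(abs_lt.1 hlt).1], by linarith [(abs_lt.1 hlt).2]⟩
    simp [hsupp t x _ hx']
  have hPbd : ∀ t x y, R < |x| → P t x y = 0 := by
    intro t x y hx
    refine hP0 t x y (hsupp t x y hx.le) ?_ ?_
    · have : (fun s => u t s y) =ᶠ[nhds x] fun _ => 0 := by
        filter_upwards [continuous_abs.continuousAt.eventually (lt_mem_nhds hx)] with s hs
        exact hsupp t s y hs.le
      rw [Dx, this.deriv_eq, deriv_const]
    · simp [Dy, hsupp t x _ hx.le]
  have hRabs : R < |R + 1| := (lt_add_one R).trans_le (le_abs_self _)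
  have hcont : ∀ {g : ℝ → ℝ → ℝ → ℝ},
      Continuous (fun p : ℝ × ℝ × ℝ => g p.1 p.2.1 p.2.2) → ∀ t x, Continuous (g t x) :=
    fun hg t x => hg.comp (by fun_prop : Continuous fun y : ℝ => (t, x, y))
  have hint : ∀ {g : ℝ → ℝ → ℝ → ℝ}, Continuous (fun p : ℝ × ℝ × ℝ => g p.1 p.2.1 p.2.2) →
      ∀ t, IntervalIntegrable (fun x => ∫ y in (0:ℝ)..L, g t x y) volume (-(R + 1)) (R + 1) := by
    intro g hg t
    exact (intervalIntegral.continuous_parametric_intervalIntegral_of_continuous'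
      (f := fun x y => g t x y) (hg.comp (by fun_prop : Continuous fun q : ℝ × ℝ => (t, q.1, q.2))) 0 L).intervalIntegrable
      _ _
  have hut := (contDiff_Dt (m := 0) (by norm_num) hu1).continuous
  have huy := (contDiff_Dy (m := 0) (by norm_num) hu1).continuous
  have hPx := (contDiff_Dx (m := 0) (by norm_num) hP).continuous
  have hQy := (contDiff_Dy (m := 0) (by norm_num) hQ).continuous
  have hcu := hu1.continuous
  have henergy : ∀ t ∈ Icc (0:ℝ) T,
      ∫ x in -(R + 1)..(R + 1), ∫ y in (0:ℝ)..L, (u t x y * Dt u t x y + β * u t x y ^ 2) ≤ 0 := by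
    intro t ht
    calc _ ≤ ∫ x in -(R + 1)..(R + 1), -∫ y in (0:ℝ)..L, Dx P t x y := by
          refine intervalIntegral.integral_mono_on (by linarith)
            (hint (g := fun t x y => u t x y * Dt u t x y + β * u t x y ^ 2)
              (by fun_prop) t) (hint hPx t).neg fun x _ => ?_
          have hQint : ∫ y in (0:ℝ)..L, Dy Q t x y = 0 := by
            rw [intervalIntegral.integral_eq_sub_of_hasDerivAt
              (fun y _ => hasDerivAt_Dy hQ t x y) ((hcont hQy t x).intervalIntegrable _ _),
              hQ0 t x L (hbcL t x) (by simp [Dx, hbcL]), hQ0 t x 0 (hbc0 t x) (by simp [Dx, hbc0]),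
              sub_zero]
          have hW := wirtinger_inequality hL (fun y => hasDerivAt_Dy hu1 t x y) (hcont huy t x)
            (hbc0 t x) (hbcL t x)
          have hc1 := hcont hcu t x
          have hc2 := hcont hut t x
          have hc3 := hcont huy t x
          have hc4 := hcont hPx t x
          have hc5 := hcont hQy t x
          have hmono : ∫ y in (0:ℝ)..L, (u t x y * Dt u t x y + β * u t x y ^ 2)
              ≤ ∫ y in (0:ℝ)..L, (-Dx P t x y - Dy Q t x y
                - β₂ x * (Dy u t x y ^ 2 - (π / L) ^ 2 * u t x y ^ 2)) := by
            refine intervalIntegral.integral_mono_on hL.le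
              (Continuous.intervalIntegrable (by fun_prop) _ _)
              (Continuous.intervalIntegrable (by fun_prop) _ _) fun y hy => ?_
            rw [hflux t x y (heq t ht x y hy)]
            have hco : β ≤ β₂ x * (π / L) ^ 2 + a₀ x y := by
              have hkβ : π ^ 2 * β₂ x / L ^ 2 = β₂ x * (π / L) ^ 2 := by ring
              linarith [hcoer x, hβ₀ x y]
            nlinarith [mul_nonneg (ha₁nn x y) (sq_nonneg (Dx u t x y)),
              mul_le_mul_of_nonneg_right (hβ₂ x y) (sq_nonneg (Dy u t x y)),
              mul_le_mul_of_nonneg_right hco (sq_nonneg (u t x y))]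
          refine hmono.trans ?_
          rw [intervalIntegral.integral_sub (Continuous.intervalIntegrable (by fun_prop) _ _)
              (Continuous.intervalIntegrable (by fun_prop) _ _),
            intervalIntegral.integral_sub (Continuous.intervalIntegrable (by fun_prop) _ _)
              (Continuous.intervalIntegrable (by fun_prop) _ _),
            intervalIntegral.integral_const_mul, intervalIntegral.integral_neg, hQint]
          linarith [mul_nonneg (hβ₂nn x) hW]
      _ = 0 := by
          rw [intervalIntegral.integral_neg, integral_integral_Dx_eq_zero hP
            (fun y => hPbd t _ y (by rwa [abs_neg])) (fun y => hPbd t _ y hRabs), neg_zero]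
  have hw1 : ContDiff ℝ 1 (fun p : ℝ × ℝ × ℝ =>
      (fun t x y => exp (2 * β * t) * u t x y ^ 2) p.1 p.2.1 p.2.2) :=
    (by fun_prop : ContDiff ℝ 1 fun p : ℝ × ℝ × ℝ => exp (2 * β * p.1)).mul (hu1.pow 2)
  have hwt : ∀ t x y, Dt (fun t x y => exp (2 * β * t) * u t x y ^ 2) t x y
      = 2 * exp (2 * β * t) * (u t x y * Dt u t x y + β * u t x y ^ 2) := by
    intro t x y
    have hlin : HasDerivAt (fun s : ℝ => 2 * β * s) (2 * β * 1) t :=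
      (hasDerivAt_id t).const_mul (2 * β)
    refine (hlin.exp.mul ((hasDerivAt_Dt hu1 t x y).pow 2)).deriv.trans ?_
    norm_num
    ring
  have hderiv := hasDerivAt_integral_integral_Dt
    (f := fun t x y => exp (2 * β * t) * u t x y ^ 2) hw1 (-(R + 1)) (R + 1) 0 L
  simp only [hwt, intervalIntegral.integral_const_mul] at hderiv
  have hanti := antitoneOn_of_deriv_nonpos (convex_Icc 0 T)
    (fun t _ => (hderiv t).continuousAt.continuousWithinAt)
    (fun t _ => (hderiv t).differentiableAt.differentiableWithinAt) (fun t ht => by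
      rw [(hderiv t).deriv]
      exact mul_nonpos_of_nonneg_of_nonpos (by positivity)
        (henergy t (interior_subset ht)))
  intro t ht
  have hdecay := hanti (left_mem_Icc.2 hT.le) ht ht.1
  simp only [← hE, mul_zero, exp_zero, one_mul] at hdecay
  rw [← sqrt_eq_rpow, ← sqrt_eq_rpow]
  refine sqrt_le_iff.2 ⟨by positivity, ?_⟩
  have hnn : 0 ≤ ∫ x : ℝ, ∫ y in Ioo (0:ℝ) L, u 0 x y ^ 2 :=
    integral_nonneg fun x => integral_nonneg fun y => sq_nonneg _
  rw [mul_pow, sq_sqrt hnn, ← exp_nat_mul]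
  calc _ = exp (-(2 * β * t)) *
        (exp (2 * β * t) * ∫ x : ℝ, ∫ y in Ioo (0:ℝ) L, u t x y ^ 2) := by
        rw [← mul_assoc, ← exp_add, neg_add_cancel, exp_zero, one_mul]
    _ ≤ exp (-(2 * β * t)) * ∫ x : ℝ, ∫ y in Ioo (0:ℝ) L, u 0 x y ^ 2 := by gcongr
    _ = _ := by congr 2; push_cast; ring
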